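/- Work in units ℓ = 1. Fix real parameters ν, r₊, r₋ with ν > 1 and r₊ > r₋ ≥ 0 and r₊ > 0, and set s = √((ν²+3)·r₊·r₋), D = 2ν·r₊ − s, Ω_H = −2/D, and r_C = (4ν²·r₊ − (ν²+3)·r₋)/(3(ν²−1)). Define f(r) = 1 + Ω_H·(2ν·r − s) + Ω_H²·R²(r), the squared norm of the horizon generator χ = ∂_t + Ω_H ∂_θ. Then for all real r one has the factorization f(r) = (3(ν²−1)/D²)·(r − r₊)·(r − r_C); in particular f(r₊) = f(r_C) = 0 (χ is null at the horizon and at the speed of light surface), r_C − r₊ = (ν²+3)(r₊−r₋)/(3(ν²−1)) > 0, and f(r) < 0 for all r with r₊ < r < r_C (χ is timelike strictly between the horizon and the speed of light surface). -/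

import Mathlib

/-- The squared norm `f(r) = 1 + Ω_H(2νr − s) + Ω_H²R²(r)` of the horizon
generator `χ = ∂_t + Ω_H ∂_θ` of the warped AdS₃ black hole factorizes as
`f(r) = (3(ν²−1)/D²)(r − r₊)(r − r_C)`; it vanishes at the horizon and at the
speed of light surface, `r_C − r₊ = (ν²+3)(r₊−r₋)/(3(ν²−1)) > 0`, and `f < 0`
strictly between the horizon and the speed of light surface. -/
theorem wads3_speed_of_light_surface (ν rp rm : ℝ) (hν : 1 < ν) (hpm : rm < rp)
    (hm0 : 0 ≤ rm) (hp0 : 0 < rp)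
    (s : ℝ) (hs : s = Real.sqrt ((ν ^ 2 + 3) * rp * rm))
    (D : ℝ) (hD : D = 2 * ν * rp - s)
    (ΩH : ℝ) (hΩH : ΩH = -2 / D)
    (rC : ℝ) (hrC : rC = (4 * ν ^ 2 * rp - (ν ^ 2 + 3) * rm) / (3 * (ν ^ 2 - 1)))
    (R2 : ℝ → ℝ)
    (hR2 : ∀ r, R2 r = r / 4 * (3 * (ν ^ 2 - 1) * r + (ν ^ 2 + 3) * (rp + rm) - 4 * ν * s))
    (f : ℝ → ℝ)
    (hf : ∀ r, f r = 1 + ΩH * (2 * ν * r - s) + ΩH ^ 2 * R2 r) :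
    (∀ r : ℝ, f r = 3 * (ν ^ 2 - 1) / D ^ 2 * (r - rp) * (r - rC)) ∧
    f rp = 0 ∧ f rC = 0 ∧
    rC - rp = (ν ^ 2 + 3) * (rp - rm) / (3 * (ν ^ 2 - 1)) ∧
    0 < rC - rp ∧
    (∀ r : ℝ, rp < r → r < rC → f r < 0) := by
  have hK : 0 < 3 * (ν ^ 2 - 1) := by nlinarith
  have hs2 : s ^ 2 = (ν ^ 2 + 3) * rp * rm := by
    rw [hs]
    exact Real.sq_sqrt (by positivity)
  have hDpos : 0 < D := by
    have h1 : s < 2 * ν * rp := by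
      apply lt_of_pow_lt_pow_left₀ 2 (by positivity)
      rw [hs2]
      have h2 : (ν ^ 2 + 3) * rp * rm < (ν ^ 2 + 3) * rp * rp :=
        mul_lt_mul_of_pos_left hpm (by positivity)
      have h3 : 0 < 3 * (ν ^ 2 - 1) * rp ^ 2 := by positivity
      nlinarith
    linarith
  have hKC : 3 * (ν ^ 2 - 1) * rC = 4 * ν ^ 2 * rp - (ν ^ 2 + 3) * rm := by
    rw [hrC]
    exact mul_div_cancel₀ _ hK.ne'
  have hfac : ∀ r : ℝ, f r = 3 * (ν ^ 2 - 1) / D ^ 2 * (r - rp) * (r - rC) := by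
    intro r
    have e1 : f r = (D ^ 2 - 2 * D * (2 * ν * r - s) + 4 * R2 r) / D ^ 2 := by
      rw [hf, hΩH]
      field_simp
      ring
    have e2 : D ^ 2 - 2 * D * (2 * ν * r - s) + 4 * R2 r
        = 3 * (ν ^ 2 - 1) * (r - rp) * (r - rC) := by
      rw [hR2, hD]
      linear_combination (r - rp) * hKC - hs2
    rw [e1, e2]
    ring
  have hdiff : rC - rp = (ν ^ 2 + 3) * (rp - rm) / (3 * (ν ^ 2 - 1)) := by
    rw [eq_div_iff hK.ne']
    linear_combination hKC
  refine ⟨hfac, by rw [hfac]; ring, by rw [hfac]; ring, hdiff, ?_, ?_⟩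
  · rw [hdiff]
    have : 0 < rp - rm := by linarith
    positivity
  · intro r h1 h2
    rw [hfac]
    have h3 : 0 < r - rp := by linarith
    have h4 : 0 < 3 * (ν ^ 2 - 1) / D ^ 2 := by positivity
    exact mul_neg_of_pos_of_neg (mul_pos h4 h3) (by linarith)
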